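/- Let Y and E be normed spaces, X a convex subset of Y, L : D(L) → F(X;E) a linear operator dominated by a positive linear operator S : D(S) → F(X;ℝ), where UCB(X;E) ⊆ D(L), UCB(X;ℝ) ⊆ D(S) and ψ_t² ∈ D(S) for every t ∈ Y, and assume L preserves the constants. Set γ(t) := (S(ψ_t²)(t))^{1/2}. Then for every F ∈ UCB(X;E) and every t ∈ X with γ(t) > 0 one has ‖L(F)(t) − F(t)‖ ≤ ω(F,γ(t))·[S(𝟙)(t) + 1]; and if K ⊆ X is such that γ and S(𝟙) are bounded on K and sup_{t∈K} γ(t) > 0, then sup_{t∈K} ‖L(F)(t) − F(t)‖ ≤ ω(F, sup_{t∈K} γ(t))·[sup_{t∈K} S(𝟙)(t) + 1]. -/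

import Mathlib

open Filter Topology Bornology

/-- The modulus of continuity of `F` on `X`:
`ω(F,h) = sup {‖F u − F t‖ : t, u ∈ X, ‖t − u‖ ≤ h}`. -/
noncomputable def modulusOfContinuity {Y E : Type*} [NormedAddCommGroup Y]
    [NormedAddCommGroup E] (X : Set Y) (F : Y → E) (h : ℝ) : ℝ :=
  sSup {r : ℝ | ∃ t ∈ X, ∃ u ∈ X, ‖t - u‖ ≤ h ∧ r = ‖F u - F t‖}

lemma norm_sub_le_modulusOfContinuity {Y E : Type*} [NormedAddCommGroup Y]
    [NormedAddCommGroup E] {X : Set Y} {F : Y → E} (hF : IsBounded (F '' X)) {h : ℝ} {t u : Y}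
    (ht : t ∈ X) (hu : u ∈ X) (htu : ‖t - u‖ ≤ h) :
    ‖F u - F t‖ ≤ modulusOfContinuity X F h := by
  obtain ⟨C, hC⟩ := hF.exists_norm_le
  refine le_csSup ⟨C + C, ?_⟩ ⟨t, ht, u, hu, htu, rfl⟩
  rintro r ⟨a, ha, b, hb, -, rfl⟩
  exact (norm_sub_le _ _).trans
    (add_le_add (hC _ (Set.mem_image_of_mem F hb)) (hC _ (Set.mem_image_of_mem F ha)))

lemma modulusOfContinuity_nonneg {Y E : Type*} [NormedAddCommGroup Y]
    [NormedAddCommGroup E] (X : Set Y) (F : Y → E) (h : ℝ) :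
    0 ≤ modulusOfContinuity X F h := by
  refine Real.sSup_nonneg ?_
  rintro r ⟨a, -, b, -, -, rfl⟩
  exact norm_nonneg _

/-- On a convex set, the oscillation over `n + 1` steps of length at most `h` is at most `n + 1`
times the modulus of continuity at `h`. -/
lemma norm_sub_le_nat_mul_modulusOfContinuity {Y E : Type*} [NormedAddCommGroup Y]
    [NormedSpace ℝ Y] [NormedAddCommGroup E] {X : Set Y} (hX : Convex ℝ X) {F : Y → E}
    (hF : IsBounded (F '' X)) {h : ℝ} {t u : Y} (ht : t ∈ X) (hu : u ∈ X) (n : ℕ)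
    (htu : ‖u - t‖ ≤ (n + 1) * h) :
    ‖F u - F t‖ ≤ (n + 1) * modulusOfContinuity X F h := by
  have hn : (0 : ℝ) < n + 1 := by positivity
  let p : ℕ → Y := fun i => AffineMap.lineMap t u ((i : ℝ) / (n + 1))
  have hp : ∀ i ≤ n + 1, p i ∈ X := fun i hi =>
    hX.lineMap_mem ht hu ⟨by positivity, by rw [div_le_one hn]; exact_mod_cast hi⟩
  have hstep : ∀ i, ‖p i - p (i + 1)‖ ≤ h := by
    intro i
    have hi : ((i : ℝ) / (n + 1)) - (((i + 1 : ℕ) : ℝ) / (n + 1)) = -(1 / (n + 1)) := by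
      push_cast
      ring
    have hpi : p i - p (i + 1) = (-(1 / ((n : ℝ) + 1))) • (u - t) := by
      rw [← hi]
      simp only [p, AffineMap.lineMap_apply_module']
      module
    rw [hpi, norm_smul, norm_neg, Real.norm_of_nonneg (by positivity), one_div,
      inv_mul_le_iff₀ hn]
    exact htu
  have h0 : p 0 = t := by simp [p]
  have h1 : p (n + 1) = u := by
    have : ((n + 1 : ℕ) : ℝ) / (n + 1) = 1 := by
      push_cast
      exact div_self hn.ne'
    simp only [p, this, AffineMap.lineMap_apply_one]
  calc ‖F u - F t‖ = ‖∑ i ∈ Finset.range (n + 1), (F (p (i + 1)) - F (p i))‖ := by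
        rw [Finset.sum_range_sub (fun i => F (p i)), h0, h1]
    _ ≤ ∑ i ∈ Finset.range (n + 1), modulusOfContinuity X F h := by
        refine norm_sum_le_of_le _ fun i hi => ?_
        have hi' : i < n + 1 := Finset.mem_range.mp hi
        exact norm_sub_le_modulusOfContinuity hF (hp i hi'.le) (hp (i + 1) hi') (hstep i)
    _ = (n + 1) * modulusOfContinuity X F h := by simp

lemma norm_sub_le_one_add_sq_mul_modulusOfContinuity {Y E : Type*} [NormedAddCommGroup Y]
    [NormedSpace ℝ Y] [NormedAddCommGroup E] {X : Set Y} (hX : Convex ℝ X) {F : Y → E}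
    (hF : IsBounded (F '' X)) {h : ℝ} (hh : 0 < h) {t u : Y} (ht : t ∈ X) (hu : u ∈ X) :
    ‖F u - F t‖ ≤ (1 + (‖u - t‖ / h) ^ 2) * modulusOfContinuity X F h := by
  set n := ⌊‖u - t‖ / h⌋₊
  have hle : (n : ℝ) ≤ ‖u - t‖ / h := Nat.floor_le (by positivity)
  have hlt : ‖u - t‖ / h < n + 1 := Nat.lt_floor_add_one _
  refine (norm_sub_le_nat_mul_modulusOfContinuity hX hF ht hu n
    ((div_lt_iff₀ hh).mp hlt).le).trans ?_
  refine mul_le_mul_of_nonneg_right ?_ (modulusOfContinuity_nonneg X F h)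
  have hsq : (n : ℝ) ≤ (n : ℝ) ^ 2 := by exact_mod_cast Nat.le_self_pow two_ne_zero n
  have := pow_le_pow_left₀ n.cast_nonneg hle 2
  linarith

theorem stmt_2
    {Y : Type*} [NormedAddCommGroup Y] [NormedSpace ℝ Y]
    {E : Type*} [NormedAddCommGroup E] [NormedSpace ℝ E]
    (X : Set Y) (hXconv : Convex ℝ X)
    (DL : Submodule ℝ (Y → E)) (DS : Submodule ℝ (Y → ℝ))
    (L : DL →ₗ[ℝ] (Y → E)) (S : DS →ₗ[ℝ] (Y → ℝ))
    -- S is positive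
    (hSpos : ∀ f : DS, (∀ u ∈ X, 0 ≤ f.1 u) → ∀ t ∈ X, 0 ≤ S f t)
    -- L is dominated by S
    (hdom_mem : ∀ F : DL, (fun u => ‖F.1 u‖) ∈ DS)
    (hdom : ∀ F : DL, ∀ t ∈ X, ‖L F t‖ ≤ S ⟨fun u => ‖F.1 u‖, hdom_mem F⟩ t)
    -- UCB(X;E) ⊆ D(L) and UCB(X;ℝ) ⊆ D(S)
    (hDL : ∀ F : Y → E, UniformContinuousOn F X → IsBounded (F '' X) → F ∈ DL)
    (hDS : ∀ f : Y → ℝ, UniformContinuousOn f X → IsBounded (f '' X) → f ∈ DS)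
    -- ψ_t² ∈ D(S) for every t ∈ Y
    (hpsi : ∀ t : Y, (fun u => ‖u - t‖ ^ 2) ∈ DS)
    -- L preserves the constants
    (hconst_mem : ∀ c : E, (fun _ : Y => c) ∈ DL)
    (hconst : ∀ c : E, ∀ t ∈ X, L ⟨fun _ => c, hconst_mem c⟩ t = c)
    -- 𝟙 ∈ D(S)
    (hone : (fun _ : Y => (1 : ℝ)) ∈ DS) :
    ∀ F : Y → E, UniformContinuousOn F X → IsBounded (F '' X) → ∀ hF : F ∈ DL,
      -- γ(t) := (S(ψ_t²)(t))^{1/2}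
      (∀ t ∈ X, 0 < Real.sqrt (S ⟨fun u => ‖u - t‖ ^ 2, hpsi t⟩ t) →
        ‖L ⟨F, hF⟩ t - F t‖ ≤
          modulusOfContinuity X F (Real.sqrt (S ⟨fun u => ‖u - t‖ ^ 2, hpsi t⟩ t)) *
            (S ⟨fun _ => 1, hone⟩ t + 1)) ∧
      (∀ K : Set Y, K ⊆ X →
        BddAbove ((fun t => Real.sqrt (S ⟨fun u => ‖u - t‖ ^ 2, hpsi t⟩ t)) '' K) →
        BddAbove ((fun t => S ⟨fun _ => 1, hone⟩ t) '' K) →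
        0 < sSup ((fun t => Real.sqrt (S ⟨fun u => ‖u - t‖ ^ 2, hpsi t⟩ t)) '' K) →
        sSup ((fun t => ‖L ⟨F, hF⟩ t - F t‖) '' K) ≤
          modulusOfContinuity X F
              (sSup ((fun t => Real.sqrt (S ⟨fun u => ‖u - t‖ ^ 2, hpsi t⟩ t)) '' K)) *
            (sSup ((fun t => S ⟨fun _ => 1, hone⟩ t) '' K) + 1)) := by
  intro F _ hFb hF
  have hγsq : ∀ t ∈ X, Real.sqrt (S ⟨fun u => ‖u - t‖ ^ 2, hpsi t⟩ t) ^ 2 =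
      S ⟨fun u => ‖u - t‖ ^ 2, hpsi t⟩ t := fun t ht =>
    Real.sq_sqrt (hSpos _ (fun u _ => sq_nonneg ‖u - t‖) t ht)
  have key : ∀ t ∈ X, ∀ δ : ℝ, 0 < δ →
      Real.sqrt (S ⟨fun u => ‖u - t‖ ^ 2, hpsi t⟩ t) ≤ δ →
      ‖L ⟨F, hF⟩ t - F t‖ ≤ modulusOfContinuity X F δ * (S ⟨fun _ => 1, hone⟩ t + 1) := by
    intro t ht δ hδ hγ
    set w := modulusOfContinuity X F δ
    have hw : 0 ≤ w := modulusOfContinuity_nonneg X F δ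
    let G : DL := ⟨F, hF⟩ - ⟨fun _ => F t, hconst_mem (F t)⟩
    have hLG : L G t = L ⟨F, hF⟩ t - F t := by
      simp only [G, map_sub, Pi.sub_apply, hconst (F t) t ht]
    have hpos := hSpos (w • ⟨fun _ => 1, hone⟩ + (w / δ ^ 2) • ⟨fun u => ‖u - t‖ ^ 2, hpsi t⟩
      - ⟨fun u => ‖G.1 u‖, hdom_mem G⟩) (fun u hu => by
        have hu' := norm_sub_le_one_add_sq_mul_modulusOfContinuity hXconv hFb hδ ht hu
        have hrw : (1 + (‖u - t‖ / δ) ^ 2) * w = w * 1 + w / δ ^ 2 * ‖u - t‖ ^ 2 := by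
          ring
        rw [hrw] at hu'
        exact sub_nonneg.mpr hu') t ht
    simp only [map_sub, map_add, map_smul, Pi.sub_apply, Pi.add_apply, Pi.smul_apply,
      smul_eq_mul] at hpos
    have hψ : w / δ ^ 2 * S ⟨fun u => ‖u - t‖ ^ 2, hpsi t⟩ t ≤ w := by
      rw [div_mul_eq_mul_div, div_le_iff₀ (by positivity), ← hγsq t ht]
      gcongr
    rw [← hLG]
    linarith [hdom G t ht]
  refine ⟨fun t ht hγ => key t ht _ hγ le_rfl, fun K hK hγb hSb hγpos => ?_⟩
  have hne : K.Nonempty := by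
    rw [Set.nonempty_iff_ne_empty]
    rintro rfl
    simp at hγpos
  refine csSup_le (hne.image _) ?_
  rintro _ ⟨t, ht, rfl⟩
  refine (key t (hK ht) _ hγpos (le_csSup hγb (Set.mem_image_of_mem _ ht))).trans ?_
  have := le_csSup hSb (Set.mem_image_of_mem _ ht)
  exact mul_le_mul_of_nonneg_left (add_le_add this le_rfl) (modulusOfContinuity_nonneg X F _)
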